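/- arXiv:1601.06395 — 6 statements merged into one kernel-verified Lean document; each statement's English description precedes it below -/
import Mathlib

section
/- The wrinkle model map W : ℝ × ℝ^{n-1} → ℝ^{n+1}, W(u,v) = (v, u³ − 3u(1−|v|²), (1/5)u⁵ − (2/3)u³(1−|v|²) + u(1−|v|²)²), is injective. -/
/-- A curve `u ↦ (u³ − 3au, u⁵/5 − (2/3)au³ + a²u)`, with `a` fixed, has no self-intersections. -/
theorem wrinkle_profile_injective (a : ℝ) :
    Function.Injective (fun u : ℝ =>
      (u ^ 3 - 3 * u * a, (1 / 5) * u ^ 5 - (2 / 3) * u ^ 3 * a + u * a ^ 2)) := by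
  intro u w h
  obtain ⟨hx, hz⟩ := Prod.mk.inj h
  by_contra hne
  have hd : u - w ≠ 0 := sub_ne_zero.mpr hne
  have ha : a = (u ^ 2 + u * w + w ^ 2) / 3 := by
    apply mul_left_cancel₀ hd
    linear_combination (-1 / 3) * hx
  subst ha
  have hfac : (u - w) ^ 3 * (4 * u ^ 2 + 7 * u * w + 4 * w ^ 2) = 0 := by
    linear_combination 45 * hz
  have hq : 4 * u ^ 2 + 7 * u * w + 4 * w ^ 2 = 0 :=
    (mul_eq_zero.mp hfac).resolve_left (pow_ne_zero 3 hd)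
  have hpos : 0 < (u - w) ^ 2 := by positivity
  nlinarith [sq_nonneg (u + w)]


/-- The wrinkle model map `W(u,v) = (v, u³ − 3u(1−|v|²),
(1/5)u⁵ − (2/3)u³(1−|v|²) + u(1−|v|²)²)` is injective. -/
theorem wrinkle_model_injective (n : ℕ) (hn : 1 ≤ n) :
    Function.Injective (fun p : ℝ × EuclideanSpace ℝ (Fin (n - 1)) =>
      ((p.2,
        p.1 ^ 3 - 3 * p.1 * (1 - ‖p.2‖ ^ 2),
        (1 / 5) * p.1 ^ 5 - (2 / 3) * p.1 ^ 3 * (1 - ‖p.2‖ ^ 2)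
          + p.1 * (1 - ‖p.2‖ ^ 2) ^ 2) :
        EuclideanSpace ℝ (Fin (n - 1)) × ℝ × ℝ)) := by
  rintro ⟨u, v⟩ ⟨w, v'⟩ h
  obtain ⟨rfl, h⟩ := Prod.mk.inj h
  exact congrArg (·, v) (wrinkle_profile_injective _ h)
end

section
/- The wrinkle model map W : ℝ × ℝ^{n-1} → ℝ^{n+1} is a topological embedding: it is a homeomorphism onto its image (with the subspace topology). -/
open Filter Topology

/-- The antiderivative in `u` of `(u ^ 2 - a) ^ 2` grows at least as fast as a fifth power,
uniformly in the parameter `a`. -/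
lemma sub_pow_five_le_quintic_sub (a s t : ℝ) (h : t ≤ s) :
    (s - t) ^ 5 ≤ 180 * (((1 / 5) * s ^ 5 - (2 / 3) * s ^ 3 * a + s * a ^ 2)
      - ((1 / 5) * t ^ 5 - (2 / 3) * t ^ 3 * a + t * a ^ 2)) := by
  have hst : 0 ≤ s - t := sub_nonneg.2 h
  have h₁ : 0 ≤ (s - t) * (((s + t) / 2) ^ 2 - a + ((s - t) / 2) ^ 2 / 3) ^ 2 := by positivity
  have h₂ : 0 ≤ (s - t) ^ 3 * (s + t) ^ 2 := by positivity
  linear_combination 180 * h₁ + 15 * h₂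

lemma abs_sub_pow_five_le_quintic_sub (a s t : ℝ) :
    |s - t| ^ 5 ≤ 180 * |((1 / 5) * s ^ 5 - (2 / 3) * s ^ 3 * a + s * a ^ 2)
      - ((1 / 5) * t ^ 5 - (2 / 3) * t ^ 3 * a + t * a ^ 2)| := by
  wlog h : t ≤ s generalizing s t
  · rw [abs_sub_comm s t, abs_sub_comm (_ - _ + _)]
    exact this t s (le_of_not_ge h)
  rw [abs_of_nonneg (sub_nonneg.2 h)]
  exact (sub_pow_five_le_quintic_sub a s t h).trans
    (mul_le_mul_of_nonneg_left (le_abs_self _) (by norm_num))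

/-- A continuous function of `(u, v)` whose increments in `u` dominate a power of `|u - u'|`,
uniformly in `v`, defines together with `v` a topological embedding. -/
lemma isEmbedding_snd_prodMk_of_abs_sub_pow_le {V : Type*} [TopologicalSpace V]
    {g : ℝ × V → ℝ} (hg : Continuous g) {C : ℝ} {k : ℕ} (hk : k ≠ 0)
    (h : ∀ s t v, |s - t| ^ k ≤ C * |g (s, v) - g (t, v)|) :
    IsEmbedding fun p : ℝ × V => (p.2, g p) := by
  refine ⟨isInducing_iff_nhds.2 fun ⟨t, w⟩ => le_antisymm ?_ ?_, ?_⟩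
  · exact map_le_iff_le_comap.1 (continuous_snd.prodMk hg).continuousAt
  · have hF : Tendsto (fun p : ℝ × V => (p.2, g p))
        (comap (fun p : ℝ × V => (p.2, g p)) (𝓝 (w, g (t, w)))) (𝓝 (w, g (t, w))) :=
      tendsto_comap
    have hv := (continuous_fst.tendsto _).comp hF
    have hz := (continuous_snd.tendsto _).comp hF
    have hz' := ((hg.comp (Continuous.prodMk_right t)).tendsto w).comp hv
    have hlim := ((hz.sub hz').abs).const_mul C
    simp only [Function.comp_def, sub_self, abs_zero, mul_zero] at hlim
    have hu : Tendsto (fun p : ℝ × V => p.1)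
        (comap (fun p : ℝ × V => (p.2, g p)) (𝓝 (w, g (t, w)))) (𝓝 t) := by
      refine Metric.tendsto_nhds.2 fun ε hε => ?_
      filter_upwards [hlim.eventually_lt_const (pow_pos hε k)] with p hp
      exact lt_of_pow_lt_pow_left₀ k hε.le ((h p.1 t p.2).trans_lt hp)
    exact hu.prodMk_nhds hv
  · rintro ⟨s, v⟩ ⟨t, w⟩ hst
    obtain ⟨rfl, hz⟩ := Prod.mk.inj hst
    have hle := h s t v
    rw [show g (s, v) = g (t, v) from hz, sub_self, abs_zero, mul_zero] at hle
    have h₀ : |s - t| = 0 := (pow_eq_zero_iff hk).1 (le_antisymm hle (by positivity))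
    rw [sub_eq_zero.1 (abs_eq_zero.1 h₀)]

/-- The wrinkle model map `W` is a topological embedding: a homeomorphism
onto its image with the subspace topology. -/
theorem wrinkle_model_embedding (n : ℕ) (hn : 1 ≤ n) :
    Topology.IsEmbedding (fun p : ℝ × EuclideanSpace ℝ (Fin (n - 1)) =>
      ((p.2,
        p.1 ^ 3 - 3 * p.1 * (1 - ‖p.2‖ ^ 2),
        (1 / 5) * p.1 ^ 5 - (2 / 3) * p.1 ^ 3 * (1 - ‖p.2‖ ^ 2)
          + p.1 * (1 - ‖p.2‖ ^ 2) ^ 2) :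
        EuclideanSpace ℝ (Fin (n - 1)) × ℝ × ℝ)) := by
  refine IsEmbedding.of_comp (g := fun q => (q.1, q.2.2)) (by fun_prop) (by fun_prop) ?_
  exact isEmbedding_snd_prodMk_of_abs_sub_pow_le
    (g := fun p : ℝ × EuclideanSpace ℝ (Fin (n - 1)) =>
      (1 / 5) * p.1 ^ 5 - (2 / 3) * p.1 ^ 3 * (1 - ‖p.2‖ ^ 2) + p.1 * (1 - ‖p.2‖ ^ 2) ^ 2)
    (by fun_prop) (by norm_num)
    fun s t v => abs_sub_pow_five_le_quintic_sub (1 - ‖v‖ ^ 2) s t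
end

section
/- The Fréchet derivative of the wrinkle model map W at a point (u,v) ∈ ℝ × ℝ^{n-1} is injective if and only if u² + |v|² ≠ 1. In particular W is a smooth immersion exactly away from the unit sphere {u² + |v|² = 1}. -/
/-- The wrinkle model map, with parameters in a real inner product space, has the expected
Fréchet derivative; its component along `u` is `(0, 3 (u² + |v|² - 1), (u² + |v|² - 1)²)`. -/
theorem wrinkle_model_hasFDerivAt {E : Type*} [NormedAddCommGroup E] [InnerProductSpace ℝ E]
    (u : ℝ) (v : E) :
    HasFDerivAt (fun p : ℝ × E =>
        ((p.2,
          p.1 ^ 3 - 3 * p.1 * (1 - ‖p.2‖ ^ 2),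
          (1 / 5) * p.1 ^ 5 - (2 / 3) * p.1 ^ 3 * (1 - ‖p.2‖ ^ 2)
            + p.1 * (1 - ‖p.2‖ ^ 2) ^ 2) : E × ℝ × ℝ))
      ((ContinuousLinearMap.snd ℝ ℝ E).prod
        (((3 * (u ^ 2 + ‖v‖ ^ 2 - 1)) • ContinuousLinearMap.fst ℝ ℝ E
            + (6 * u) • (innerSL ℝ v).comp (ContinuousLinearMap.snd ℝ ℝ E)).prod
          ((u ^ 2 + ‖v‖ ^ 2 - 1) ^ 2 • ContinuousLinearMap.fst ℝ ℝ E
            + (4 / 3 * u ^ 3 - 4 * u * (1 - ‖v‖ ^ 2)) •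
              (innerSL ℝ v).comp (ContinuousLinearMap.snd ℝ ℝ E))))
      (u, v) := by
  have hfst : HasFDerivAt (fun p : ℝ × E => p.1) (ContinuousLinearMap.fst ℝ ℝ E) (u, v) :=
    hasFDerivAt_fst
  have hsnd : HasFDerivAt (fun p : ℝ × E => p.2) (ContinuousLinearMap.snd ℝ ℝ E) (u, v) :=
    hasFDerivAt_snd
  have hr := hsnd.norm_sq.const_sub 1
  refine hsnd.prodMk (HasFDerivAt.prodMk ?_ ?_)
  · refine ((hfst.pow 3).sub ((hfst.const_mul 3).mul hr)).congr_fderiv ?_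
    ext <;> simp <;> ring
  · refine ((((hfst.pow 5).const_mul (1 / 5)).sub
      (((hfst.pow 3).const_mul (2 / 3)).mul hr)).add (hfst.mul (hr.pow 2))).congr_fderiv ?_
    ext <;> simp <;> ring

/-- The Fréchet derivative of the wrinkle model map `W` at `(u,v)` is
injective if and only if `u² + |v|² ≠ 1`: `W` is an immersion exactly away
from the unit sphere. -/
theorem wrinkle_model_fderiv_injective_iff (n : ℕ) (hn : 1 ≤ n)
    (u : ℝ) (v : EuclideanSpace ℝ (Fin (n - 1))) :
    Function.Injective
      (fderiv ℝ (fun p : ℝ × EuclideanSpace ℝ (Fin (n - 1)) =>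
        ((p.2,
          p.1 ^ 3 - 3 * p.1 * (1 - ‖p.2‖ ^ 2),
          (1 / 5) * p.1 ^ 5 - (2 / 3) * p.1 ^ 3 * (1 - ‖p.2‖ ^ 2)
            + p.1 * (1 - ‖p.2‖ ^ 2) ^ 2) :
          EuclideanSpace ℝ (Fin (n - 1)) × ℝ × ℝ)) (u, v)) ↔
      u ^ 2 + ‖v‖ ^ 2 ≠ 1 := by
  rw [(wrinkle_model_hasFDerivAt u v).fderiv]
  constructor
  · intro hinj h
    have h0 : u ^ 2 + ‖v‖ ^ 2 - 1 = 0 := sub_eq_zero.mpr h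
    have h1 := @hinj (1, 0) 0 (by simp [h0])
    simp at h1
  · intro h
    refine (injective_iff_map_eq_zero _).mpr ?_
    rintro ⟨a, w⟩ haw
    have h0 : u ^ 2 + ‖v‖ ^ 2 - 1 ≠ 0 := sub_ne_zero.mpr h
    obtain ⟨rfl, hx, -⟩ : w = 0 ∧ _ ∧ _ := by simpa using haw
    simpa [h0] using hx
end

section
/- For every t ∈ ℝ, the map (u,x₂) ↦ F_t(u,x₂) = (x₁(u,x₂,t), x₂, y₁(u,x₂,t), y₂(u,x₂,t), z(u,x₂,t)) is a Legendrian lift of the wrinkle front: the partial derivatives satisfy ∂z/∂u = y₁ · ∂x₁/∂u and ∂z/∂x₂ = y₁ · ∂x₁/∂x₂ + y₂ at every point (u,x₂) ∈ ℝ². Equivalently, the pullback under F_t of the 1-form dz − y₁dx₁ − y₂dx₂ vanishes identically. -/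
/-- The map `F_t(u,x₂) = (x₁, x₂, y₁, y₂, z)` is a Legendrian lift of the
wrinkle front: `∂z/∂u = y₁·∂x₁/∂u` and `∂z/∂x₂ = y₁·∂x₁/∂x₂ + y₂`, i.e. the
pullback of `dz − y₁dx₁ − y₂dx₂` vanishes. -/
theorem wrinkle_legendrian_lift (t u x₂ : ℝ) :
    deriv (fun u : ℝ =>
        (1 / 5) * u ^ 5 - (2 / 3) * u ^ 3 * (t - x₂ ^ 2) + u * (t - x₂ ^ 2) ^ 2) u
      = ((1 / 3) * (u ^ 2 + x₂ ^ 2 - t)) *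
          deriv (fun u : ℝ => u ^ 3 - 3 * u * (t - x₂ ^ 2)) u
    ∧ deriv (fun x₂ : ℝ =>
        (1 / 5) * u ^ 5 - (2 / 3) * u ^ 3 * (t - x₂ ^ 2) + u * (t - x₂ ^ 2) ^ 2) x₂
      = ((1 / 3) * (u ^ 2 + x₂ ^ 2 - t)) *
          deriv (fun x₂ : ℝ => u ^ 3 - 3 * u * (t - x₂ ^ 2)) x₂
        + (-(2 / 3) * u ^ 3 * x₂ - 2 * u * x₂ * (t - x₂ ^ 2)) := by
  have hu := hasDerivAt_id' u
  have hx := ((hasDerivAt_id' x₂).fun_pow 2).const_sub t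
  have hzu := ((((hu.fun_pow 5).const_mul (1 / 5)).fun_sub
    (((hu.fun_pow 3).const_mul (2 / 3)).mul_const (t - x₂ ^ 2))).fun_add
      (hu.mul_const ((t - x₂ ^ 2) ^ 2)))
  have hxu := (hu.fun_pow 3).fun_sub ((hu.const_mul 3).mul_const (t - x₂ ^ 2))
  have hzx := ((hx.const_mul ((2 / 3) * u ^ 3)).const_sub ((1 / 5) * u ^ 5)).fun_add
    ((hx.fun_pow 2).const_mul u)
  have hxx := (hx.const_mul (3 * u)).const_sub (u ^ 3)
  rw [hzu.deriv, hxu.deriv, hzx.deriv, hxx.deriv]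
  constructor <;> norm_num <;> ring
end

section
/- For each t ∈ ℝ, the Fréchet derivative of the front map W_t : ℝ² → ℝ³, W_t(u,x₂) = (x₁, x₂, z) with x₁ = u³ − 3u(t − x₂²) and z = (1/5)u⁵ − (2/3)u³(t − x₂²) + u(t − x₂²)², is injective at (u,x₂) if and only if u² + x₂² ≠ t. In particular, for t < 0 the map W_t is an immersion on all of ℝ², and for t > 0 its singular locus is exactly the circle u² + x₂² = t. -/
open ContinuousLinearMap in
/-- The derivative of the front map, with the partial derivatives of `x₁` and `z` in the `u`
direction factored through `u² + x₂² - t`. -/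
theorem hasFDerivAt_front (t u x₂ : ℝ) :
    HasFDerivAt (fun p : ℝ × ℝ =>
        ((p.1 ^ 3 - 3 * p.1 * (t - p.2 ^ 2),
          p.2,
          (1 / 5) * p.1 ^ 5 - (2 / 3) * p.1 ^ 3 * (t - p.2 ^ 2)
            + p.1 * (t - p.2 ^ 2) ^ 2) : ℝ × ℝ × ℝ))
      (((3 * (u ^ 2 + x₂ ^ 2 - t)) • fst ℝ ℝ ℝ + (6 * u * x₂) • snd ℝ ℝ ℝ).prod
        ((snd ℝ ℝ ℝ).prod
          (((u ^ 2 + x₂ ^ 2 - t) ^ 2) • fst ℝ ℝ ℝ +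
            (4 / 3 * u ^ 3 * x₂ - 4 * u * x₂ * (t - x₂ ^ 2)) • snd ℝ ℝ ℝ))) (u, x₂) := by
  have hu : HasFDerivAt (fun p : ℝ × ℝ => p.1) (fst ℝ ℝ ℝ) (u, x₂) := hasFDerivAt_fst
  have hx : HasFDerivAt (fun p : ℝ × ℝ => p.2) (snd ℝ ℝ ℝ) (u, x₂) := hasFDerivAt_snd
  have hs := (hx.pow 2).const_sub t
  refine HasFDerivAt.prodMk ?_ (hx.prodMk ?_)
  · refine ((hu.pow 3).sub ((hu.const_mul 3).mul hs)).congr_fderiv ?_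
    ext <;> simp <;> ring
  · refine ((((hu.pow 5).const_mul (1 / 5)).sub (((hu.pow 3).const_mul (2 / 3)).mul hs)).add
      (hu.mul (hs.pow 2))).congr_fderiv ?_
    ext <;> simp <;> ring

/-- The Fréchet derivative of the front map `W_t(u,x₂) = (x₁, x₂, z)` is
injective at `(u,x₂)` if and only if `u² + x₂² ≠ t`. -/
theorem front_fderiv_injective_iff (t u x₂ : ℝ) :
    Function.Injective
      (fderiv ℝ (fun p : ℝ × ℝ =>
        ((p.1 ^ 3 - 3 * p.1 * (t - p.2 ^ 2),
          p.2,
          (1 / 5) * p.1 ^ 5 - (2 / 3) * p.1 ^ 3 * (t - p.2 ^ 2)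
            + p.1 * (t - p.2 ^ 2) ^ 2) : ℝ × ℝ × ℝ)) (u, x₂)) ↔
      u ^ 2 + x₂ ^ 2 ≠ t := by
  rw [(hasFDerivAt_front t u x₂).fderiv, injective_iff_map_eq_zero]
  constructor
  · intro h ht
    have := h (1, 0) (by simp [ht])
    simp at this
  · rintro h ⟨a, b⟩ hab
    have ht : u ^ 2 + x₂ ^ 2 - t ≠ 0 := sub_ne_zero.mpr h
    simp only [ContinuousLinearMap.prod_apply, add_apply, smul_apply,
      ContinuousLinearMap.coe_fst', ContinuousLinearMap.coe_snd', smul_eq_mul,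
      Prod.mk_eq_zero] at hab
    obtain ⟨hx₁, rfl, -⟩ := hab
    simpa [ht] using hx₁
end

section
/- For each t > 0, the Fréchet derivative of the Legendrian lift F_t : ℝ² → ℝ⁵, F_t(u,x₂) = (x₁, x₂, y₁, y₂, z), is injective at (u,x₂) if and only if it is not the case that u = 0 and x₂² = t; that is, the lift fails to be an immersion exactly at the two legendrian wrinkle points (0, √t) and (0, −√t). -/
/-- The Fréchet derivative of the Legendrian lift, evaluated at a tangent vector. -/
theorem lift_fderiv_apply (t u x₂ : ℝ) (v : ℝ × ℝ) :
    fderiv ℝ (fun p : ℝ × ℝ =>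
        ((p.1 ^ 3 - 3 * p.1 * (t - p.2 ^ 2),
          p.2,
          (1 / 3) * (p.1 ^ 2 + p.2 ^ 2 - t),
          -(2 / 3) * p.1 ^ 3 * p.2 - 2 * p.1 * p.2 * (t - p.2 ^ 2),
          (1 / 5) * p.1 ^ 5 - (2 / 3) * p.1 ^ 3 * (t - p.2 ^ 2)
            + p.1 * (t - p.2 ^ 2) ^ 2) : ℝ × ℝ × ℝ × ℝ × ℝ)) (u, x₂) v =
      (3 * (u ^ 2 - (t - x₂ ^ 2)) * v.1 + 6 * u * x₂ * v.2,
        v.2,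
        (2 / 3) * (u * v.1 + x₂ * v.2),
        -2 * x₂ * (u ^ 2 + (t - x₂ ^ 2)) * v.1
          + (-(2 / 3) * u ^ 3 - 2 * u * (t - x₂ ^ 2) + 4 * u * x₂ ^ 2) * v.2,
        (u ^ 2 - (t - x₂ ^ 2)) ^ 2 * v.1
          + ((4 / 3) * u ^ 3 * x₂ - 4 * u * x₂ * (t - x₂ ^ 2)) * v.2) := by
  have h1 : HasFDerivAt (fun p : ℝ × ℝ => p.1) (ContinuousLinearMap.fst ℝ ℝ ℝ) (u, x₂) :=
    hasFDerivAt_fst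
  have h2 : HasFDerivAt (fun p : ℝ × ℝ => p.2) (ContinuousLinearMap.snd ℝ ℝ ℝ) (u, x₂) :=
    hasFDerivAt_snd
  have hs := (h2.pow 2).const_sub t
  have hx := (h1.pow 3).sub ((h1.const_mul 3).mul hs)
  have hy₁ := (((h1.pow 2).add (h2.pow 2)).sub_const t).const_mul (1 / 3)
  have hy₂ := (((h1.pow 3).const_mul (-(2 / 3))).mul h2).sub
    (((h1.const_mul 2).mul h2).mul hs)
  have hz := (((h1.pow 5).const_mul (1 / 5)).sub
    (((h1.pow 3).const_mul (2 / 3)).mul hs)).add (h1.mul (hs.pow 2))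
  have h := hx.prodMk (h2.prodMk (hy₁.prodMk (hy₂.prodMk hz)))
  refine (congrArg (fun L : ℝ × ℝ →L[ℝ] ℝ × ℝ × ℝ × ℝ × ℝ => L v) h.fderiv).trans ?_
  ext <;> simp <;> ring

/-- For `t > 0`, the Fréchet derivative of the Legendrian lift
`F_t(u,x₂) = (x₁, x₂, y₁, y₂, z)` is injective at `(u,x₂)` iff it is not the
case that `u = 0` and `x₂² = t`: the lift fails to be an immersion exactly at
the two Legendrian wrinkle points `(0, ±√t)`. -/
theorem lift_fderiv_injective_iff (t : ℝ) (ht : 0 < t) (u x₂ : ℝ) :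
    Function.Injective
      (fderiv ℝ (fun p : ℝ × ℝ =>
        ((p.1 ^ 3 - 3 * p.1 * (t - p.2 ^ 2),
          p.2,
          (1 / 3) * (p.1 ^ 2 + p.2 ^ 2 - t),
          -(2 / 3) * p.1 ^ 3 * p.2 - 2 * p.1 * p.2 * (t - p.2 ^ 2),
          (1 / 5) * p.1 ^ 5 - (2 / 3) * p.1 ^ 3 * (t - p.2 ^ 2)
            + p.1 * (t - p.2 ^ 2) ^ 2) : ℝ × ℝ × ℝ × ℝ × ℝ)) (u, x₂)) ↔
      ¬(u = 0 ∧ x₂ ^ 2 = t) := by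
  rw [injective_iff_map_eq_zero]
  simp only [lift_fderiv_apply, Prod.mk_eq_zero]
  constructor
  · rintro h ⟨rfl, rfl⟩
    have h10 := h (1, 0) (by simp)
    simp at h10
  · rintro h ⟨a, b⟩ ⟨hx, rfl, hy, -, -⟩
    simp only [mul_zero, add_zero] at hx hy
    by_contra ha
    replace ha : a ≠ 0 := fun h0 => ha (by simp [h0])
    have hu : u = 0 := by simpa [ha] using hy
    subst hu
    refine h ⟨rfl, ?_⟩
    have hs : 3 * ((0 : ℝ) ^ 2 - (t - x₂ ^ 2)) = 0 := (mul_eq_zero.mp hx).resolve_right ha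
    linarith
end
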